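/- For all α, z ∈ ℂ \ {0} and every n ∈ ℤ, the Wronskian satisfies f_{n+1}(z) g_n(z) − f_n(z) g_{n+1}(z) = −z^{−1} θ_q(α z). Consequently, {f_n(z)} and {g_n(z)} are linearly independent sequences if and only if z ∉ {α^{−1} q^k : k ∈ ℤ}. -/

import Mathlib

open Complex Filter Topology

/-- Finite q-Pochhammer symbol `(a;q)_n`. -/
noncomputable def qp (q a : ℂ) (n : ℕ) : ℂ := ∏ k ∈ Finset.range n, (1 - a * q ^ k)

/-- Infinite q-Pochhammer symbol `(a;q)_∞`. -/
noncomputable def qpInf (q a : ℂ) : ℂ := ∏' k : ℕ, (1 - a * q ^ k)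

/-- Theta function `θ_q(x) = (x;q)_∞ (q/x;q)_∞`. -/
noncomputable def theta (q x : ℂ) : ℂ := qpInf q x * qpInf q (q / x)

/-- Regularized confluent basic hypergeometric series `₁φ̃₁(0;b;q,w)`. -/
noncomputable def phiT (q b w : ℂ) : ℂ :=
  ∑' k : ℕ, qpInf q (b * q ^ k) * (-1) ^ k * q ^ (k * (k - 1) / 2) * w ^ k / qp q q k

/-- The solution `f_n(z)`. -/
noncomputable def fseq (q α z : ℂ) (n : ℤ) : ℂ :=
  (-1) ^ n * α ^ (-n) * q ^ (n * (n + 1) / 2) *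
    phiT q (q ^ (n + 1) / (α * z)) (z * q ^ (n + 1) / α)

/-- The solution `g_n(z)`. -/
noncomputable def gseq (q α z : ℂ) (n : ℤ) : ℂ :=
  z ^ (-n) * phiT q (α * z * q ^ (1 - n)) (q * z ^ 2)

section QPochhammer

variable {q : ℂ}

lemma summable_norm_mul_pow (hq : ‖q‖ < 1) (a : ℂ) : Summable fun k : ℕ => ‖-(a * q ^ k)‖ := by
  simpa using (summable_geometric_of_lt_one (norm_nonneg q) hq).mul_left ‖a‖

lemma multipliable_qpInf (hq : ‖q‖ < 1) (a : ℂ) : Multipliable fun k : ℕ => 1 - a * q ^ k := by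
  simpa [sub_eq_add_neg] using multipliable_one_add_of_summable (summable_norm_mul_pow hq a)

lemma qpInf_eq_mul (hq : ‖q‖ < 1) (a : ℂ) : qpInf q a = (1 - a) * qpInf q (a * q) := by
  have h : ∀ k : ℕ, 1 - a * q ^ (k + 1) = 1 - a * q * q ^ k := fun k => by ring
  unfold qpInf
  rw [tprod_eq_zero_mul' (by simpa only [h] using multipliable_qpInf hq (a * q))]
  simp only [h, pow_zero, mul_one]

lemma tendsto_qp (hq : ‖q‖ < 1) (a : ℂ) : Tendsto (qp q a) atTop (𝓝 (qpInf q a)) :=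
  (multipliable_qpInf hq a).tendsto_prod_tprod_nat

lemma norm_qpInf_sub_one_le (hq : ‖q‖ < 1) (a : ℂ) :
    ‖qpInf q a - 1‖ ≤ Real.exp (‖a‖ * (1 - ‖q‖)⁻¹) - 1 := by
  refine le_of_tendsto ((tendsto_qp hq a).sub_const 1).norm (Eventually.of_forall fun n => ?_)
  have h := Finset.norm_prod_one_add_sub_one_le (Finset.range n) fun k => -(a * q ^ k)
  simp only [← sub_eq_add_neg] at h
  refine h.trans (sub_le_sub_right (Real.exp_le_exp.2 ?_) 1)
  refine ((summable_norm_mul_pow hq a).sum_le_tsum _ fun _ _ => norm_nonneg _).trans_eq ?_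
  simp [tsum_mul_left, tsum_geometric_of_lt_one (norm_nonneg q) hq]

lemma norm_qpInf_le (hq : ‖q‖ < 1) (a : ℂ) :
    ‖qpInf q a‖ ≤ Real.exp (‖a‖ * (1 - ‖q‖)⁻¹) := by
  have h := norm_add_le (qpInf q a - 1) 1
  rw [sub_add_cancel, norm_one] at h
  linarith [norm_qpInf_sub_one_le hq a]

lemma norm_qpInf_mul_pow_le (hq : ‖q‖ < 1) (a : ℂ) (k : ℕ) :
    ‖qpInf q (a * q ^ k)‖ ≤ Real.exp (‖a‖ * (1 - ‖q‖)⁻¹) := by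
  refine (norm_qpInf_le hq _).trans (Real.exp_le_exp.2 ?_)
  have : 0 ≤ (1 - ‖q‖)⁻¹ := inv_nonneg.2 (by linarith)
  gcongr
  rw [norm_mul, norm_pow]
  exact mul_le_of_le_one_right (norm_nonneg a) (pow_le_one₀ (norm_nonneg q) hq.le)

lemma tendsto_qpInf_mul_pow (hq : ‖q‖ < 1) (a : ℂ) :
    Tendsto (fun n : ℕ => qpInf q (a * q ^ n)) atTop (𝓝 1) := by
  rw [tendsto_iff_norm_sub_tendsto_zero]
  have h : Tendsto (fun n : ℕ => Real.exp (‖a * q ^ n‖ * (1 - ‖q‖)⁻¹) - 1) atTop (𝓝 0) := by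
    have h₀ : Tendsto (fun n : ℕ => ‖a * q ^ n‖ * (1 - ‖q‖)⁻¹) atTop (𝓝 0) := by
      simpa using (((tendsto_pow_atTop_nhds_zero_of_norm_lt_one hq).const_mul a).norm).mul_const
        (1 - ‖q‖)⁻¹
    simpa using ((Real.continuous_exp.tendsto 0).comp h₀).sub_const 1
  exact squeeze_zero (fun _ => norm_nonneg _) (fun n => norm_qpInf_sub_one_le hq _) h

lemma qpInf_eq_zero_iff (hq : ‖q‖ < 1) (a : ℂ) : qpInf q a = 0 ↔ ∃ k : ℕ, a * q ^ k = 1 := by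
  constructor
  · intro h
    by_contra! hne
    refine tprod_one_add_ne_zero_of_summable (f := fun k : ℕ => -(a * q ^ k)) (fun k => ?_)
      (summable_norm_mul_pow hq a) (by simpa [qpInf, sub_eq_add_neg] using h)
    rw [← sub_eq_add_neg]
    exact sub_ne_zero.2 (hne k).symm
  · rintro ⟨k, hk⟩
    exact tprod_of_exists_eq_zero ⟨k, by rw [hk, sub_self]⟩

lemma theta_eq_zero_iff (hq0 : q ≠ 0) (hq : ‖q‖ < 1) {x : ℂ} (hx : x ≠ 0) :
    theta q x = 0 ↔ ∃ k : ℤ, x = q ^ k := by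
  rw [theta, mul_eq_zero, qpInf_eq_zero_iff hq, qpInf_eq_zero_iff hq]
  constructor
  · rintro (⟨k, hk⟩ | ⟨k, hk⟩)
    · refine ⟨-k, ?_⟩
      rw [zpow_neg, zpow_natCast]
      exact eq_inv_of_mul_eq_one_left hk
    · refine ⟨k + 1, ?_⟩
      rw [zpow_add_one₀ hq0, zpow_natCast]
      field_simp at hk
      rw [← hk]
      ring
  · rintro ⟨k, rfl⟩
    rcases le_or_gt k 0 with hk | hk
    · obtain ⟨m, rfl⟩ := Int.exists_eq_neg_ofNat hk
      refine Or.inl ⟨m, ?_⟩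
      rw [zpow_neg, zpow_natCast, inv_mul_cancel₀ (pow_ne_zero _ hq0)]
    · obtain ⟨m, rfl⟩ := Int.eq_succ_of_zero_lt hk
      refine Or.inr ⟨m, ?_⟩
      rw [zpow_add_one₀ hq0, zpow_natCast]
      field_simp

end QPochhammer

section ConfluentSeries

variable {q : ℂ}

/-- The coefficient `(-1)^k q^{k(k-1)/2} w^k / (q;q)_k` in the series `₁φ̃₁(0;b;q,w)`. -/
noncomputable def phiCoeff (q w : ℂ) (k : ℕ) : ℂ :=
  (-1) ^ k * q ^ (k * (k - 1) / 2) * w ^ k / qp q q k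

lemma phiT_eq_tsum (q b w : ℂ) : phiT q b w = ∑' k, qpInf q (b * q ^ k) * phiCoeff q w k :=
  tsum_congr fun k => by rw [phiCoeff]; ring

@[simp] lemma phiCoeff_zero (q w : ℂ) : phiCoeff q w 0 = 1 := by simp [phiCoeff, qp]

lemma phiCoeff_mul (q a w : ℂ) (k : ℕ) : phiCoeff q (a * w) k = a ^ k * phiCoeff q w k := by
  rw [phiCoeff, phiCoeff, mul_pow]; ring

lemma one_sub_pow_succ_ne_zero (hq : ‖q‖ < 1) (k : ℕ) : 1 - q ^ (k + 1) ≠ 0 := by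
  intro h
  have h₁ : ‖q ^ (k + 1)‖ = 1 := by rw [← sub_eq_zero.1 h, norm_one]
  rw [norm_pow] at h₁
  exact (pow_lt_one₀ (norm_nonneg q) hq k.succ_ne_zero).ne h₁

lemma phiCoeff_succ (hq : ‖q‖ < 1) (w : ℂ) (k : ℕ) :
    (1 - q ^ (k + 1)) * phiCoeff q w (k + 1) = -w * (q ^ k * phiCoeff q w k) := by
  have h₁ := one_sub_pow_succ_ne_zero hq k
  have h₂ : qp q q (k + 1) = qp q q k * (1 - q ^ (k + 1)) := by
    rw [qp, qp, Finset.prod_range_succ, pow_succ']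
  have h₃ : (k + 1) * (k + 1 - 1) / 2 = k * (k - 1) / 2 + k := by
    rw [← Finset.sum_range_id, ← Finset.sum_range_id, Finset.sum_range_succ]
  rw [phiCoeff, phiCoeff, h₂, h₃]
  field_simp
  ring

lemma summable_norm_phiCoeff (hq : ‖q‖ < 1) (w : ℂ) : Summable fun k => ‖phiCoeff q w k‖ := by
  have hp := tendsto_pow_atTop_nhds_zero_of_norm_lt_one hq
  have h : Tendsto (fun k : ℕ => ‖-w * q ^ k / (1 - q ^ (k + 1))‖) atTop (𝓝 0) := by
    have := ((hp.const_mul (-w)).div (((tendsto_add_atTop_iff_nat 1).2 hp).const_sub 1)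
      (by simp)).norm
    simpa using this
  refine summable_of_ratio_norm_eventually_le (r := 1 / 2) (by norm_num) ?_
  filter_upwards [h.eventually_le_const (show (0 : ℝ) < 1 / 2 by norm_num)] with k hk
  have h₁ := one_sub_pow_succ_ne_zero hq k
  have h₂ : phiCoeff q w (k + 1) = -w * q ^ k / (1 - q ^ (k + 1)) * phiCoeff q w k := by
    have := phiCoeff_succ hq w k
    field_simp
    linear_combination this
  rw [norm_norm, norm_norm, h₂, norm_mul]
  gcongr

lemma summable_phiT (hq : ‖q‖ < 1) (b w : ℂ) :
    Summable fun k => qpInf q (b * q ^ k) * phiCoeff q w k := by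
  refine Summable.of_norm_bounded
    ((summable_norm_phiCoeff hq w).mul_left (Real.exp (‖b‖ * (1 - ‖q‖)⁻¹))) fun k => ?_
  rw [norm_mul]
  gcongr
  exact norm_qpInf_mul_pow_le hq b k

lemma phiT_eq_sub_mul_left (hq : ‖q‖ < 1) (b w : ℂ) :
    phiT q b w = phiT q (b * q) w - b * phiT q (b * q) (q * w) := by
  simp only [phiT_eq_tsum]
  rw [← tsum_mul_left, ← (summable_phiT hq _ _).tsum_sub ((summable_phiT hq _ _).mul_left b)]
  refine tsum_congr fun k => ?_
  rw [qpInf_eq_mul hq (b * q ^ k), phiCoeff_mul, mul_right_comm b]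
  ring

lemma phiT_eq_sub_mul_right (hq : ‖q‖ < 1) (b w : ℂ) :
    phiT q b w = phiT q b (q * w) - w * phiT q (b * q) (q * w) := by
  rw [sub_eq_add_neg, ← sub_eq_iff_eq_add', ← neg_mul]
  simp only [phiT_eq_tsum]
  have h := (summable_phiT hq b w).sub (summable_phiT hq b (q * w))
  rw [← (summable_phiT hq b w).tsum_sub (summable_phiT hq b (q * w)), h.tsum_eq_zero_add,
    ← tsum_mul_left]
  simp only [phiCoeff_zero, sub_self, zero_add]
  refine tsum_congr fun k => ?_
  rw [phiCoeff_mul, phiCoeff_mul, mul_left_comm (-w), ← phiCoeff_succ hq, pow_succ' q k,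
    ← mul_assoc b]
  ring

/-- Contiguous relation in the lower parameter. -/
lemma phiT_recurrence_left (hq0 : q ≠ 0) (hq : ‖q‖ < 1) {b : ℂ} (hb : b ≠ 0) (w : ℂ) :
    phiT q b (q * w) = (1 + w - b) * phiT q (b * q) (q * w) - w * phiT q (b * q * q) (q * w) := by
  have h₁ := phiT_eq_sub_mul_left hq b (q * w)
  have h₂ := phiT_eq_sub_mul_left hq (b * q) (q * w)
  have h₃ := phiT_eq_sub_mul_right hq (b * q) (q * w)
  refine mul_left_cancel₀ (mul_ne_zero hb hq0) ?_
  linear_combination (b * q) * h₁ - (b * q * w) * h₂ + (b ^ 2 * q) * h₃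

/-- Contiguous relation along the diagonal. -/
lemma phiT_recurrence_diagonal (hq : ‖q‖ < 1) (b w : ℂ) :
    phiT q b w = (1 - w - b) * phiT q (b * q) (q * w)
      - w * b * q * phiT q (b * q * q) (q * (q * w)) := by
  have h₁ := phiT_eq_sub_mul_left hq b w
  have h₂ := phiT_eq_sub_mul_right hq (b * q) w
  have h₃ := phiT_eq_sub_mul_left hq (b * q) (q * w)
  linear_combination h₁ + h₂ + w * h₃

lemma tendsto_phiT_diagonal (hq : ‖q‖ < 1) (b w : ℂ) :
    Tendsto (fun n : ℕ => phiT q (b * q ^ n) (q ^ n * w)) atTop (𝓝 1) := by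
  simp only [phiT_eq_tsum, phiCoeff_mul]
  have h : (1 : ℂ) = ∑' k, if k = 0 then 1 else 0 := by simp
  rw [h]
  refine tendsto_tsum_of_dominated_convergence
    ((summable_norm_phiCoeff hq w).mul_left (Real.exp (‖b‖ * (1 - ‖q‖)⁻¹))) (fun k => ?_)
    (Eventually.of_forall fun n k => ?_)
  · have h₁ : Tendsto (fun n : ℕ => qpInf q (b * q ^ n * q ^ k)) atTop (𝓝 1) := by
      simpa only [mul_right_comm] using tendsto_qpInf_mul_pow hq (b * q ^ k)
    rcases Nat.eq_zero_or_pos k with rfl | hk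
    · simpa using h₁
    · have h₂ : Tendsto (fun n : ℕ => (q ^ n) ^ k) atTop (𝓝 0) := by
        simpa [hk.ne'] using (tendsto_pow_atTop_nhds_zero_of_norm_lt_one hq).pow k
      simpa [hk.ne'] using h₁.mul (h₂.mul_const (phiCoeff q w k))
  · rw [norm_mul, norm_mul, mul_assoc, ← pow_add]
    gcongr
    · exact norm_qpInf_mul_pow_le hq b _
    · rw [norm_pow, norm_pow, ← pow_mul]
      exact mul_le_of_le_one_left (norm_nonneg _) (pow_le_one₀ (norm_nonneg q) hq.le)

/-- The finite products `(q/x;q)_n (x;q)_∞` in the form in which they occur when the lower parameter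
of `₁φ̃₁` is `x q^{-n}`, together with their shifts by `k`. -/
noncomputable def thetaApprox (q x : ℂ) (n k : ℕ) : ℂ :=
  (-x⁻¹) ^ n * q ^ (n * (n + 1) / 2) * qpInf q (x / q ^ n * q ^ k)

lemma pow_triangular_succ (q : ℂ) (n : ℕ) :
    q ^ ((n + 1) * (n + 1 + 1) / 2) = q ^ (n * (n + 1) / 2) * q ^ (n + 1) := by
  rw [← pow_add, show (n + 1) * (n + 1 + 1) = n * (n + 1) + (n + 1) * 2 by ring,
    Nat.add_mul_div_right _ _ two_pos]

lemma thetaApprox_succ_succ (hq0 : q ≠ 0) (x : ℂ) (n k : ℕ) :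
    thetaApprox q x (n + 1) (k + 1) = -x⁻¹ * q ^ (n + 1) * thetaApprox q x n k := by
  have h : x / q ^ (n + 1) * q ^ (k + 1) = x / q ^ n * q ^ k := by
    field_simp
    ring
  rw [thetaApprox, thetaApprox, pow_triangular_succ, h]
  ring

lemma thetaApprox_zero_right (hq0 : q ≠ 0) (hq : ‖q‖ < 1) {x : ℂ} (hx : x ≠ 0) (n : ℕ) :
    thetaApprox q x n 0 = qpInf q x * qp q (q / x) n := by
  induction n with
  | zero => simp [thetaApprox, qp]
  | succ n ih =>
    have h₁ : x / q ^ (n + 1) * q = x / q ^ n := by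
      field_simp
      ring
    have h₂ : qp q (q / x) (n + 1) = qp q (q / x) n * (1 - q / x * q ^ n) :=
      Finset.prod_range_succ _ _
    have h₃ : -x⁻¹ * q ^ (n + 1) * (1 - x / q ^ (n + 1)) = 1 - q / x * q ^ n := by
      field_simp
      ring
    rw [h₂, ← mul_assoc, ← ih, thetaApprox, thetaApprox, pow_triangular_succ, pow_zero, mul_one,
      mul_one, qpInf_eq_mul hq (x / q ^ (n + 1)), h₁, ← h₃]
    ring

lemma tendsto_thetaApprox_zero_right (hq0 : q ≠ 0) (hq : ‖q‖ < 1) {x : ℂ} (hx : x ≠ 0) :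
    Tendsto (fun n => thetaApprox q x n 0) atTop (𝓝 (theta q x)) := by
  simp only [thetaApprox_zero_right hq0 hq hx]
  exact (tendsto_qp hq (q / x)).const_mul _

lemma exists_norm_thetaApprox_le (hq0 : q ≠ 0) (hq : ‖q‖ < 1) {x : ℂ} (hx : x ≠ 0) :
    ∃ C : ℝ, ∀ n k, ‖thetaApprox q x n k‖ ≤ C * (1 + ‖x‖⁻¹) ^ k := by
  obtain ⟨C, hC⟩ := (tendsto_thetaApprox_zero_right hq0 hq hx).norm.bddAbove_range
  have hD : 1 ≤ 1 + ‖x‖⁻¹ := le_add_of_nonneg_right (inv_nonneg.2 (norm_nonneg x))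
  have hC' : ∀ n, ‖thetaApprox q x n 0‖ ≤ C := fun n => hC ⟨n, rfl⟩
  have hC0 : 0 ≤ C := (norm_nonneg _).trans (hC' 0)
  set M := Real.exp (‖x‖ * (1 - ‖q‖)⁻¹)
  have hM : 0 ≤ M := Real.exp_nonneg _
  refine ⟨C + M, fun n k => ?_⟩
  induction k generalizing n with
  | zero => simpa using (hC' n).trans (le_add_of_nonneg_right hM)
  | succ k ih =>
    cases n with
    | zero =>
      have h : ‖thetaApprox q x 0 (k + 1)‖ ≤ M := by
        simpa [thetaApprox] using norm_qpInf_mul_pow_le hq x (k + 1)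
      exact (h.trans (le_add_of_nonneg_left hC0)).trans
        (le_mul_of_one_le_right (add_nonneg hC0 hM) (one_le_pow₀ hD))
    | succ n =>
      rw [thetaApprox_succ_succ hq0, norm_mul, norm_mul, norm_neg, norm_inv, norm_pow]
      have h : ‖x‖⁻¹ * ‖q‖ ^ (n + 1) ≤ 1 + ‖x‖⁻¹ :=
        (mul_le_of_le_one_right (inv_nonneg.2 (norm_nonneg x))
          (pow_le_one₀ (norm_nonneg q) hq.le)).trans (le_add_of_nonneg_left zero_le_one)
      calc _ ≤ (1 + ‖x‖⁻¹) * ((C + M) * (1 + ‖x‖⁻¹) ^ k) :=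
            mul_le_mul h (ih n) (norm_nonneg _) (zero_le_one.trans hD)
        _ = _ := by ring

lemma tendsto_thetaApprox_succ_right (hq0 : q ≠ 0) (hq : ‖q‖ < 1) {x : ℂ} (hx : x ≠ 0) (k : ℕ) :
    Tendsto (fun n => thetaApprox q x n (k + 1)) atTop (𝓝 0) := by
  obtain ⟨C, hC⟩ := exists_norm_thetaApprox_le hq0 hq hx
  rw [← tendsto_add_atTop_iff_nat 1]
  simp only [thetaApprox_succ_succ hq0]
  have h : Tendsto (fun n : ℕ => -x⁻¹ * q ^ (n + 1)) atTop (𝓝 0) := by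
    simpa using ((tendsto_add_atTop_iff_nat 1).2
      (tendsto_pow_atTop_nhds_zero_of_norm_lt_one hq)).const_mul (-x⁻¹)
  exact h.zero_mul_isBoundedUnder_le (isBoundedUnder_of ⟨_, fun n => hC n k⟩)

/-- Asymptotics of `₁φ̃₁` for a large lower parameter. -/
lemma tendsto_phiT_div_pow (hq0 : q ≠ 0) (hq : ‖q‖ < 1) {x : ℂ} (hx : x ≠ 0) (w : ℂ) :
    Tendsto (fun n : ℕ => (-x⁻¹) ^ n * q ^ (n * (n + 1) / 2) * phiT q (x / q ^ n) w) atTop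
      (𝓝 (theta q x)) := by
  obtain ⟨C, hC⟩ := exists_norm_thetaApprox_le hq0 hq hx
  have h₁ : ∀ n : ℕ, (-x⁻¹) ^ n * q ^ (n * (n + 1) / 2) * phiT q (x / q ^ n) w =
      ∑' k, thetaApprox q x n k * phiCoeff q w k := fun n => by
    rw [phiT_eq_tsum, ← tsum_mul_left]
    exact tsum_congr fun k => by rw [thetaApprox]; ring
  have h₂ : theta q x = ∑' k, if k = 0 then theta q x else 0 := by simp
  simp only [h₁]
  rw [h₂]
  refine tendsto_tsum_of_dominated_convergence
    ((summable_norm_phiCoeff hq (((1 + ‖x‖⁻¹ : ℝ) : ℂ) * w)).mul_left C) (fun k => ?_)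
    (Eventually.of_forall fun n k => ?_)
  · cases k with
    | zero => simpa using tendsto_thetaApprox_zero_right hq0 hq hx
    | succ k =>
      simpa using (tendsto_thetaApprox_succ_right hq0 hq hx k).mul_const (phiCoeff q w (k + 1))
  · have hD : 0 ≤ 1 + ‖x‖⁻¹ := by positivity
    rw [norm_mul, phiCoeff_mul, norm_mul, norm_pow, Complex.norm_of_nonneg hD, ← mul_assoc]
    gcongr
    exact hC n k

end ConfluentSeries

section ThreeTermRecurrence

variable {K : Type*} [Field K] {u v : ℤ → K} {c : ℤ → K}

lemma casoratian_eq_of_recurrence (hu : ∀ n, u (n + 2) + u n = c n * u (n + 1))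
    (hv : ∀ n, v (n + 2) + v n = c n * v (n + 1)) (m n : ℤ) :
    u (m + 1) * v m - u m * v (m + 1) = u (n + 1) * v n - u n * v (n + 1) := by
  have h : ∀ k, u (k + 1 + 1) * v (k + 1) - u (k + 1) * v (k + 1 + 1) =
      u (k + 1) * v k - u k * v (k + 1) := fun k => by
    have h₁ := hu k
    have h₂ := hv k
    rw [show k + 1 + 1 = k + 2 by ring]
    linear_combination v (k + 1) * h₁ - u (k + 1) * h₂
  have h₀ : ∀ m, u (m + 1) * v m - u m * v (m + 1) = u (0 + 1) * v 0 - u 0 * v (0 + 1) := fun m => by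
    induction m with
    | zero => rfl
    | succ i ih => rw [h, ih]
    | pred i ih =>
      rw [← ih, ← h (-(i : ℤ) - 1), sub_add_cancel]
  rw [h₀ m, h₀ n]

lemma eq_zero_of_recurrence (hu : ∀ n, u (n + 2) + u n = c n * u (n + 1)) (h0 : u 0 = 0)
    (h1 : u 1 = 0) (n : ℤ) : u n = 0 := by
  have h : ∀ n, u n = 0 ∧ u (n + 1) = 0 := fun n => by
    induction n with
    | zero => exact ⟨h0, by simpa using h1⟩
    | succ i ih =>
      refine ⟨ih.2, ?_⟩
      have := hu i
      rwa [ih.1, ih.2, add_zero, mul_zero, show (i : ℤ) + 2 = i + 1 + 1 by ring] at this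
    | pred i ih =>
      have := hu (-(i : ℤ) - 1)
      rw [show -(i : ℤ) - 1 + 2 = -i + 1 by ring, sub_add_cancel, ih.1, ih.2, zero_add,
        mul_zero] at this
      exact ⟨this, by rw [sub_add_cancel, ih.1]⟩
  exact (h n).1

lemma linearIndependent_iff_casoratian_ne_zero (hu : ∀ n, u (n + 2) + u n = c n * u (n + 1))
    (hv : ∀ n, v (n + 2) + v n = c n * v (n + 1)) :
    (∀ a b : K, (∀ n, a * u n + b * v n = 0) → a = 0 ∧ b = 0) ↔ u 1 * v 0 - u 0 * v 1 ≠ 0 := by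
  constructor
  · intro h hW
    have hcomb : ∀ a b : K, a * u 0 + b * v 0 = 0 → a * u 1 + b * v 1 = 0 → a = 0 ∧ b = 0 :=
      fun a b h₀ h₁ => h a b <| eq_zero_of_recurrence (u := fun n => a * u n + b * v n) (c := c)
        (fun n => by linear_combination a * hu n + b * hv n) h₀ h₁
    have hu0 : u 0 = 0 :=
      neg_eq_zero.1 (hcomb (v 0) (-u 0) (by ring) (by linear_combination hW)).2
    have hu1 : u 1 = 0 :=
      neg_eq_zero.1 (hcomb (v 1) (-u 1) (by linear_combination -hW) (by ring)).2
    exact one_ne_zero (hcomb 1 0 (by simp [hu0]) (by simp [hu1])).1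
  · intro hW a b h
    refine ⟨(mul_eq_zero.1 ?_).resolve_right hW, (mul_eq_zero.1 ?_).resolve_right hW⟩
    · linear_combination v 0 * h 1 - v 1 * h 0
    · linear_combination u 1 * h 0 - u 0 * h 1

end ThreeTermRecurrence

section Solutions

variable {q α z : ℂ}

/-- The factor in front of the series in `fseq`. -/
noncomputable def fPrefactor (q α : ℂ) (n : ℤ) : ℂ :=
  (-1) ^ n * α ^ (-n) * q ^ (n * (n + 1) / 2)

lemma fPrefactor_succ (hq0 : q ≠ 0) (hα : α ≠ 0) (n : ℤ) :
    fPrefactor q α (n + 1) = -(q ^ (n + 1) / α) * fPrefactor q α n := by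
  have h : (n + 1) * (n + 1 + 1) / 2 = n * (n + 1) / 2 + (n + 1) := by
    rw [show (n + 1) * (n + 1 + 1) = n * (n + 1) + (n + 1) * 2 by ring,
      Int.add_mul_ediv_right _ _ two_ne_zero]
  rw [fPrefactor, fPrefactor, h, zpow_add₀ hq0 (n * (n + 1) / 2), zpow_add_one₀ (by norm_num),
    neg_add, zpow_add₀ hα, zpow_neg_one]
  ring

lemma fPrefactor_natCast (q α : ℂ) (n : ℕ) :
    fPrefactor q α n = (-α⁻¹) ^ n * q ^ (n * (n + 1) / 2) := by
  have h : (n : ℤ) * (n + 1) / 2 = ((n * (n + 1) / 2 : ℕ) : ℤ) := by push_cast; rfl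
  rw [fPrefactor, h, zpow_natCast, zpow_natCast, zpow_neg, zpow_natCast, neg_pow α⁻¹, inv_pow]

lemma fseq_eq (q α z : ℂ) (n : ℤ) : fseq q α z n =
    fPrefactor q α n * phiT q (q ^ (n + 1) / (α * z)) (z * q ^ (n + 1) / α) := rfl

lemma fseq_recurrence (hq0 : q ≠ 0) (hq : ‖q‖ < 1) (hα : α ≠ 0) (hz : z ≠ 0) (n : ℤ) :
    fseq q α z (n + 2) + fseq q α z n =
      (z + z⁻¹ - α * q ^ (-(n + 1))) * fseq q α z (n + 1) := by
  have hQ : q ^ (n + 1) ≠ 0 := zpow_ne_zero _ hq0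
  have h := phiT_recurrence_diagonal hq (q ^ (n + 1) / (α * z)) (z * q ^ (n + 1) / α)
  rw [show n + 2 = n + 1 + 1 by ring, fseq_eq, fseq_eq, fseq_eq, fPrefactor_succ hq0 hα (n + 1),
    fPrefactor_succ hq0 hα n, zpow_add_one₀ hq0 (n + 1 + 1), zpow_add_one₀ hq0 (n + 1), zpow_neg]
  generalize q ^ (n + 1) = Q at *
  rw [show Q / (α * z) * q * q = Q * q * q / (α * z) by ring,
    show Q / (α * z) * q = Q * q / (α * z) by ring,
    show q * (q * (z * Q / α)) = z * (Q * q * q) / α by ring,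
    show q * (z * Q / α) = z * (Q * q) / α by ring] at h
  rw [h]
  field_simp
  ring

lemma gseq_recurrence (hq0 : q ≠ 0) (hq : ‖q‖ < 1) (hα : α ≠ 0) (hz : z ≠ 0) (n : ℤ) :
    gseq q α z (n + 2) + gseq q α z n =
      (z + z⁻¹ - α * q ^ (-(n + 1))) * gseq q α z (n + 1) := by
  have hQ : q ^ (-(n + 1)) ≠ 0 := zpow_ne_zero _ hq0
  have hb : α * z * q ^ (-(n + 1)) ≠ 0 := mul_ne_zero (mul_ne_zero hα hz) hQ
  have h := phiT_recurrence_left hq0 hq hb (z ^ 2)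
  rw [gseq, gseq, gseq, show 1 - (n + 2) = -(n + 1) by ring,
    show 1 - (n + 1) = -(n + 1) + 1 by ring, show 1 - n = -(n + 1) + 1 + 1 by ring,
    zpow_add_one₀ hq0, zpow_add_one₀ hq0, ← mul_assoc (α * z), ← mul_assoc (α * z), ← mul_assoc,
    h, neg_add, neg_add, zpow_add₀ hz, zpow_add₀ hz, zpow_neg_one,
    show z ^ (-2 : ℤ) = (z ^ 2)⁻¹ by rw [zpow_neg]; rfl]
  field_simp
  ring

lemma fPrefactor_mul_gseq_succ (q α z : ℂ) (n : ℕ) :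
    fPrefactor q α n * gseq q α z (n + 1) = z⁻¹ * ((-(α * z)⁻¹) ^ n * q ^ (n * (n + 1) / 2) *
      phiT q (α * z / q ^ n) (q * z ^ 2)) := by
  have h : z ^ (-((n : ℤ) + 1)) = z⁻¹ ^ n * z⁻¹ := by
    rw [← inv_zpow', ← pow_succ, ← zpow_natCast]; rfl
  rw [fPrefactor_natCast, gseq, show 1 - ((n : ℤ) + 1) = -n by ring, h, zpow_neg, zpow_natCast,
    ← div_eq_mul_inv (α * z), mul_inv, ← neg_mul, mul_pow]
  ring

lemma tendsto_phiT_fseq (hq0 : q ≠ 0) (hq : ‖q‖ < 1) (α z : ℂ) :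
    Tendsto (fun n : ℕ => phiT q (q ^ ((n : ℤ) + 1) / (α * z)) (z * q ^ ((n : ℤ) + 1) / α)) atTop
      (𝓝 1) := by
  refine (tendsto_phiT_diagonal hq (q / (α * z)) (z * q / α)).congr fun n => ?_
  rw [zpow_add_one₀ hq0, zpow_natCast]
  rw [show q / (α * z) * q ^ n = q ^ n * q / (α * z) by ring,
    show q ^ n * (z * q / α) = z * (q ^ n * q) / α by ring]

lemma casoratian_fseq_gseq (hq0 : q ≠ 0) (hq : ‖q‖ < 1) (hα : α ≠ 0) (hz : z ≠ 0) (n : ℤ) :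
    fseq q α z (n + 1) * gseq q α z n - fseq q α z n * gseq q α z (n + 1) =
      -z⁻¹ * theta q (α * z) := by
  have hL : Tendsto (fun n : ℕ => fPrefactor q α n * gseq q α z (n + 1)) atTop
      (𝓝 (z⁻¹ * theta q (α * z))) := by
    simp only [fPrefactor_mul_gseq_succ]
    exact (tendsto_phiT_div_pow hq0 hq (mul_ne_zero hα hz) _).const_mul _
  have hF := tendsto_phiT_fseq hq0 hq α z
  have hp := tendsto_pow_atTop_nhds_zero_of_norm_lt_one hq
  have h₁ : Tendsto (fun n : ℕ => fseq q α z (n + 1) * gseq q α z (n + 2)) atTop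
      (𝓝 (z⁻¹ * theta q (α * z))) := by
    have := (tendsto_add_atTop_iff_nat 1).2 (hF.mul hL)
    rw [one_mul] at this
    refine this.congr fun n => ?_
    push_cast
    rw [fseq_eq, show (n : ℤ) + 2 = n + 1 + 1 by ring]
    ring
  have h₂ : Tendsto (fun n : ℕ => fseq q α z (n + 2) * gseq q α z (n + 1)) atTop (𝓝 0) := by
    have hq' : Tendsto (fun n : ℕ => q ^ (n + 2) * q ^ (n + 1) / α ^ 2) atTop (𝓝 0) := by
      simpa using (((tendsto_add_atTop_iff_nat 2).2 hp).mul
        ((tendsto_add_atTop_iff_nat 1).2 hp)).div_const (α ^ 2)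
    have := (hq'.mul ((tendsto_add_atTop_iff_nat 2).2 hF)).mul hL
    rw [zero_mul, zero_mul] at this
    refine this.congr fun n => ?_
    have e₁ : q ^ ((n : ℤ) + 1 + 1) = q ^ (n + 2) := by exact_mod_cast rfl
    have e₂ : q ^ ((n : ℤ) + 1) = q ^ (n + 1) := by exact_mod_cast rfl
    push_cast
    rw [fseq_eq, show fPrefactor q α ((n : ℤ) + 2) = fPrefactor q α (n + 1 + 1) by
        rw [add_assoc]; rfl,
      fPrefactor_succ hq0 hα, fPrefactor_succ hq0 hα, e₁, e₂]
    ring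
  have h₃ := h₂.sub h₁
  rw [zero_sub, ← neg_mul] at h₃
  refine tendsto_nhds_unique (tendsto_const_nhds.congr fun m : ℕ => ?_) h₃
  rw [casoratian_eq_of_recurrence (fseq_recurrence hq0 hq hα hz) (gseq_recurrence hq0 hq hα hz)
    n (m + 1), show (m : ℤ) + 1 + 1 = m + 2 by ring]

end Solutions

theorem stmt_12 (q : ℝ) (hq0 : 0 < q) (hq1 : q < 1) (α z : ℂ) (hα : α ≠ 0) (hz : z ≠ 0) :
    (∀ n : ℤ, fseq (q : ℂ) α z (n + 1) * gseq (q : ℂ) α z n -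
        fseq (q : ℂ) α z n * gseq (q : ℂ) α z (n + 1) = -z⁻¹ * theta (q : ℂ) (α * z)) ∧
    ((∀ a b : ℂ,
        (∀ n : ℤ, a * fseq (q : ℂ) α z n + b * gseq (q : ℂ) α z n = 0) → a = 0 ∧ b = 0) ↔
      ¬∃ k : ℤ, z = α⁻¹ * (q : ℂ) ^ k) := by
  have hq0' : (q : ℂ) ≠ 0 := by exact_mod_cast hq0.ne'
  have hq : ‖(q : ℂ)‖ < 1 := by rwa [Complex.norm_of_nonneg hq0.le]
  have hW := casoratian_fseq_gseq hq0' hq hα hz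
  refine ⟨hW, ?_⟩
  have hW0 := hW 0
  rw [zero_add] at hW0
  rw [linearIndependent_iff_casoratian_ne_zero (fseq_recurrence hq0' hq hα hz)
    (gseq_recurrence hq0' hq hα hz), hW0, ne_eq, mul_eq_zero,
    or_iff_right (neg_ne_zero.2 (inv_ne_zero hz)), theta_eq_zero_iff hq0' hq (mul_ne_zero hα hz)]
  simp only [eq_inv_mul_iff_mul_eq₀ hα]
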